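/- There is an absolute constant C > 0 such that for every finite field F_q and every subset A of SL₂(F_q) with |A| > C·q^{8/3}, one has A·A·A = SL₂(F_q). -/

import Mathlib

open Pointwise

open Matrix Matrix.SpecialLinearGroup

section SpecialLinear

variable {F : Type*} [Field F]

theorem diag2_mul_transvection (a : F) (ha : a ≠ 0) (b : F) :
    diag2 a ha * transvection zero_ne_one b = transvection zero_ne_one (a ^ 2 * b) * diag2 a ha := by
  ext i j
  fin_cases i <;> fin_cases j <;>
    simp [diag2_coe, transvection_coe]
  field_simp

theorem transvection_mul_diag2 (a : F) (ha : a ≠ 0) (b : F) :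
    transvection zero_ne_one b * diag2 a ha =
      diag2 a ha * transvection zero_ne_one ((a ^ 2)⁻¹ * b) := by
  rw [diag2_mul_transvection, mul_inv_cancel_left₀ (pow_ne_zero 2 ha)]

/-- Conjugation by the Weyl element exchanges lower and upper transvections. -/
theorem exists_conj_transvection (b : F) :
    ∃ w : SpecialLinearGroup (Fin 2) F, transvection one_ne_zero b =
      w * transvection zero_ne_one (-b) * w⁻¹ := by
  obtain ⟨w, hw⟩ : ∃ w : SpecialLinearGroup (Fin 2) F, w.1 = !![0, -1; 1, 0] :=
    ⟨⟨_, by simp⟩, rfl⟩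
  refine ⟨w, eq_mul_inv_of_mul_eq ?_⟩
  ext i j
  rw [coe_mul, coe_mul, transvection_coe, transvection_coe]
  fin_cases i <;> fin_cases j <;> simp [Matrix.mul_apply, hw]

/-- A subgroup that contains all conjugates of the upper transvections is everything. -/
theorem mem_of_conj_transvection_mem (H : Subgroup (SpecialLinearGroup (Fin 2) F))
    (h : ∀ (g : SpecialLinearGroup (Fin 2) F) (b : F),
      g * transvection zero_ne_one b * g⁻¹ ∈ H)
    (g : SpecialLinearGroup (Fin 2) F) : g ∈ H := by
  refine SL2.transvection_induction (· ∈ H) (fun i j hij c ↦ ?_) (fun _ _ ↦ H.mul_mem) g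
  fin_cases i
  · obtain rfl : j = 1 := by fin_cases j <;> tauto
    simpa using h 1 c
  · obtain rfl : j = 0 := by fin_cases j <;> tauto
    obtain ⟨w, hw⟩ := exists_conj_transvection c
    exact hw ▸ h w (-c)

theorem card_units_le_two_mul_card_squares [Fintype F] [DecidableEq F] :
    Fintype.card Fˣ ≤ 2 * (Finset.univ.image fun a : Fˣ ↦ a ^ 2).card := by
  refine Finset.card_le_mul_card_image _ 2 fun b hb ↦ ?_
  obtain ⟨a, -, rfl⟩ := Finset.mem_image.1 hb
  refine (Finset.card_le_card (t := {a, -a}) fun c hc ↦ ?_).trans Finset.card_le_two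
  have h : (c : F) ^ 2 = (a : F) ^ 2 := by exact_mod_cast (Finset.mem_filter.1 hc).2
  simpa [Units.ext_iff] using sq_eq_sq_iff_eq_or_eq_neg.1 h

theorem card_specialLinearGroup_le [Fintype F] [DecidableEq F] :
    Fintype.card (SpecialLinearGroup (Fin 2) F) ≤ 2 * Fintype.card F ^ 3 := by
  let φ : SpecialLinearGroup (Fin 2) F → (F × F × F) ⊕ (F × F × F) := fun g ↦
    if g 0 0 = 0 then .inl (g 0 1, g 1 0, g 1 1) else .inr (g 0 0, g 0 1, g 1 0)
  have hφ : Function.Injective φ := by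
    intro g h hgh
    have hg := g.det_coe
    have hh := h.det_coe
    rw [det_fin_two] at hg hh
    simp only [φ] at hgh
    ext i j
    split_ifs at hgh with h1 h2 h2
    · simp only [Sum.inl.injEq, Prod.mk.injEq] at hgh
      fin_cases i <;> fin_cases j <;> simp_all
    · simp only [Sum.inr.injEq, Prod.mk.injEq] at hgh
      obtain ⟨e1, e2, e3⟩ := hgh
      have e4 : g 1 1 = h 1 1 := by
        apply mul_left_cancel₀ h1
        rw [e2, e3] at hg
        rw [← e1] at hh
        linear_combination hg - hh
      fin_cases i <;> fin_cases j <;> assumption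
  refine (Fintype.card_le_of_injective φ hφ).trans_eq ?_
  simp only [Fintype.card_sum, Fintype.card_prod]
  ring

end SpecialLinear

section Representation

open scoped ComplexConjugate InnerProductSpace

variable {E : Type*} [NormedAddCommGroup E] [InnerProductSpace ℂ E]

/-- The unnormalised projection of `v` to the `ψ`-isotypic part of an action of a finite
abelian group. -/
noncomputable def isotypicSum {F : Type*} [AddCommGroup F] [Fintype F] (u : F → E →ₗ[ℂ] E)
    (ψ : AddChar F ℂ) (v : E) : E :=
  ∑ s, ψ (-s) • u s v

section AddAction

variable {F : Type*} [AddCommGroup F] [Fintype F] {u : F → E →ₗ[ℂ] E}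

theorem apply_isotypicSum (hu : ∀ s t v, u (s + t) v = u s (u t v)) (ψ : AddChar F ℂ) (v : E)
    (s : F) : u s (isotypicSum u ψ v) = ψ s • isotypicSum u ψ v := by
  unfold isotypicSum
  simp only [map_sum, map_smul, ← hu, Finset.smul_sum, smul_smul, ← AddChar.map_add_eq_mul]
  refine Fintype.sum_equiv (Equiv.addLeft s) _ _ fun t ↦ ?_
  simp

theorem sum_isotypicSum (hu₀ : ∀ v, u 0 v = v) (v : E) :
    ∑ ψ : AddChar F ℂ, isotypicSum u ψ v = (Fintype.card F : ℂ) • v := by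
  classical
  unfold isotypicSum
  rw [Finset.sum_comm]
  simp only [← Finset.sum_smul, AddChar.sum_apply_eq_ite, neg_eq_zero, ite_smul, zero_smul]
  simp [hu₀]

theorem exists_isotypicSum_ne_zero (hu : ∀ s t v, u (s + t) v = u s (u t v))
    (hu₀ : ∀ v, u 0 v = v) {v : E} {s : F} (hv : u s v ≠ v) :
    ∃ ψ : AddChar F ℂ, ψ ≠ 0 ∧ isotypicSum u ψ v ≠ 0 := by
  by_contra! h
  have hsum := sum_isotypicSum hu₀ v
  rw [Fintype.sum_eq_single 0 h] at hsum
  have hfix := apply_isotypicSum hu 0 v s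
  have hcard : (Fintype.card F : ℂ) ≠ 0 := by simp
  rw [AddChar.zero_apply, one_smul, hsum, map_smul] at hfix
  exact hv (smul_right_injective E hcard hfix)

end AddAction

theorem inner_eq_zero_of_eigenvalue_ne {F : Type*} [AddCommGroup F] [Finite F] (U : E →ₗᵢ[ℂ] E)
    {χ₁ χ₂ : AddChar F ℂ} {s t : F} {v w : E} (hv : U v = χ₁ s • v) (hw : U w = χ₂ t • w)
    (h : χ₁ s ≠ χ₂ t) : ⟪v, w⟫_ℂ = 0 := by
  have key := U.inner_map_map v w
  rw [hv, hw, inner_smul_left, inner_smul_right, ← AddChar.map_neg_eq_conj,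
    AddChar.map_neg_eq_inv] at key
  by_contra hne
  have h0 : χ₁ s ≠ 0 := (χ₁.val_isUnit s).ne_zero
  field_simp at key
  exact h key.symm

/-- Frobenius: in a unitary representation of `SL₂(F)`, an invariant subspace containing a vector
that is not fixed contains at least `(q - 1) / 2` orthonormal vectors. -/
theorem exists_orthonormal_of_not_fixed {F : Type*} [Field F] [Fintype F] [DecidableEq F]
    (ρ : SpecialLinearGroup (Fin 2) F →* (E ≃ₗᵢ[ℂ] E)) (V : Submodule ℂ E)
    (hV : ∀ g, ∀ v ∈ V, ρ g v ∈ V) {v : E} (hvV : v ∈ V)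
    {g : SpecialLinearGroup (Fin 2) F} (hg : ρ g v ≠ v) :
    ∃ (S : Finset Fˣ) (e : S → E), Fintype.card F ≤ 2 * S.card + 1 ∧ Orthonormal ℂ e ∧
      ∀ i, e i ∈ V := by
  let u : F → E →ₗ[ℂ] E := fun s ↦ (ρ (transvection zero_ne_one s)).toLinearEquiv
  have hu : ∀ s t v, u (s + t) v = u s (u t v) := by
    intro s t v
    simp only [u, transvection_add, map_mul]
    rfl
  have hu₀ : ∀ v, u 0 v = v := by
    intro v
    simp only [u, transvection_coeff_zero, map_one]
    rfl
  obtain ⟨v', hv'V, s, hs⟩ : ∃ v' ∈ V, ∃ s, u s v' ≠ v' := by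
    by_contra! h
    let H : Subgroup (SpecialLinearGroup (Fin 2) F) :=
      { carrier := {g | ∀ v ∈ V, ρ g v = v}
        one_mem' := by simp
        mul_mem' := by
          intro a b ha hb v hv
          simp [hb v hv, ha v hv]
        inv_mem' := by
          intro a ha v hv
          rw [map_inv]
          exact (ρ a).injective ((LinearIsometryEquiv.apply_symm_apply _ _).trans (ha v hv).symm) }
    refine hg (mem_of_conj_transvection_mem H (fun k b w hw ↦ ?_) g v hvV)
    have hfix : ρ (transvection zero_ne_one b) (ρ k⁻¹ w) = ρ k⁻¹ w := h _ (hV _ _ hw) b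
    rw [map_mul, map_mul, LinearIsometryEquiv.coe_mul, LinearIsometryEquiv.coe_mul,
      Function.comp_apply, Function.comp_apply, hfix, ← Function.comp_apply (f := ρ k),
      ← LinearIsometryEquiv.coe_mul, ← map_mul, mul_inv_cancel, map_one]
    rfl
  obtain ⟨ψ, hψ, hw⟩ := exists_isotypicSum_ne_zero hu hu₀ hs
  set w := isotypicSum u ψ v'
  have hwV : w ∈ V := V.sum_mem fun t _ ↦ V.smul_mem _ (hV _ _ hv'V)
  have huw : ∀ t, ρ (transvection zero_ne_one t) w = ψ t • w := apply_isotypicSum hu ψ v'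
  have hroot : ∀ c : Finset.univ.image (fun a : Fˣ ↦ a ^ 2), ∃ a : Fˣ, a ^ 2 = c.1 := fun c ↦ by
    simpa only [Finset.mem_image, Finset.mem_univ, true_and] using c.2
  choose r hr using hroot
  let d : Fˣ → SpecialLinearGroup (Fin 2) F := fun a ↦ diag2 (a : F) a.ne_zero
  have hud : ∀ (a : Fˣ) t, ρ (transvection zero_ne_one t) (ρ (d a) w) =
      ψ (((a : F) ^ 2)⁻¹ * t) • ρ (d a) w := by
    intro a t
    rw [← map_smul, ← huw, ← Function.comp_apply (f := ρ _) (x := w),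
      ← LinearIsometryEquiv.coe_mul, ← map_mul, transvection_mul_diag2, map_mul]
    rfl
  have hprim : ψ.IsPrimitive := AddChar.IsPrimitive.of_ne_one hψ
  refine ⟨Finset.univ.image fun a : Fˣ ↦ a ^ 2, fun c ↦ (‖w‖⁻¹ : ℂ) • ρ (d (r c)) w,
    ?_, ⟨fun c ↦ ?_, fun c c' hcc' ↦ ?_⟩, fun c ↦ V.smul_mem _ (hV _ _ hwV)⟩
  · have := card_units_le_two_mul_card_squares (F := F)
    rw [Fintype.card_units] at this
    omega
  · rw [norm_smul, LinearIsometryEquiv.norm_map]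
    simp [hw]
  · have hne : ψ.mulShift (((r c : F) ^ 2)⁻¹) ≠ ψ.mulShift (((r c' : F) ^ 2)⁻¹) := by
      refine (AddChar.to_mulShift_inj_of_isPrimitive hprim).ne fun h ↦ hcc' (Subtype.ext ?_)
      rw [← hr c, ← hr c', Units.ext_iff]
      simpa using h
    obtain ⟨t, ht⟩ := DFunLike.ne_iff.1 hne
    have h0 := inner_eq_zero_of_eigenvalue_ne (ρ (transvection zero_ne_one t)).toLinearIsometry
      (hud (r c) t) (hud (r c') t) ht
    simp [inner_smul_left, inner_smul_right, h0]

end Representation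

section Operator

open scoped InnerProductSpace

/-- The largest singular value of an operator, with its space of right singular vectors. -/
theorem exists_sq_norm_apply_le {E : Type*} [NormedAddCommGroup E] [InnerProductSpace ℂ E]
    [FiniteDimensional ℂ E] [Nontrivial E] (T : E →ₗ[ℂ] E) :
    ∃ (l : ℝ) (v : E), v ≠ 0 ∧ (∀ w, ⟪T w, T v⟫_ℂ = l * ⟪w, v⟫_ℂ) ∧
      ∀ w, ‖T w‖ ^ 2 ≤ l * ‖w‖ ^ 2 := by
  have hS : (LinearMap.adjoint T ∘ₗ T).IsSymmetric := fun x y ↦ by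
    simp [LinearMap.adjoint_inner_left, LinearMap.adjoint_inner_right]
  obtain ⟨v, hv⟩ := hS.hasEigenvalue_iSup_of_finiteDimensional.exists_hasEigenvector
  have hre : ∀ w, RCLike.re ⟪(LinearMap.adjoint T ∘ₗ T) w, w⟫_ℂ = ‖T w‖ ^ 2 := fun w ↦ by
    rw [LinearMap.comp_apply, LinearMap.adjoint_inner_left, inner_self_eq_norm_sq]
  simp only [hre] at hv
  refine ⟨⨆ x : {x : E // x ≠ 0}, ‖T x‖ ^ 2 / ‖(x : E)‖ ^ 2, v, hv.2, fun w ↦ ?_, fun w ↦ ?_⟩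
  · rw [← LinearMap.adjoint_inner_right, ← LinearMap.comp_apply, hv.apply_eq_smul,
      inner_smul_right]
    rfl
  · rcases eq_or_ne w 0 with rfl | hw
    · simp
    have hbdd : BddAbove (Set.range fun x : {x : E // x ≠ 0} ↦ ‖T x‖ ^ 2 / ‖(x : E)‖ ^ 2) := by
      refine ⟨‖LinearMap.toContinuousLinearMap T‖ ^ 2, ?_⟩
      rintro _ ⟨⟨x, hx⟩, rfl⟩
      have hx' : 0 < ‖x‖ := norm_pos_iff.2 hx
      simp only
      rw [div_le_iff₀ (by positivity), ← mul_pow]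
      gcongr
      exact (LinearMap.toContinuousLinearMap T).le_opNorm x
    have hw' : 0 < ‖w‖ := norm_pos_iff.2 hw
    rw [← div_le_iff₀ (by positivity)]
    exact le_ciSup hbdd ⟨w, hw⟩

end Operator

section Convolution

open scoped InnerProductSpace

variable {G : Type*} [Group G] [Fintype G]

/-- Left convolution by `f`. -/
noncomputable def leftConv (f : G → ℂ) : EuclideanSpace ℂ G →ₗ[ℂ] EuclideanSpace ℂ G where
  toFun v := WithLp.toLp 2 fun x ↦ ∑ y, f (x * y⁻¹) * v y
  map_add' v w := by
    ext x
    simp [mul_add, Finset.sum_add_distrib]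
  map_smul' c v := by
    ext x
    simp [Finset.mul_sum, mul_left_comm]

theorem leftConv_apply (f : G → ℂ) (v : EuclideanSpace ℂ G) (x : G) :
    leftConv f v x = ∑ y, f (x * y⁻¹) * v y := rfl

/-- The right regular representation, as unitary operators. -/
noncomputable def rightRegular : G →* (EuclideanSpace ℂ G ≃ₗᵢ[ℂ] EuclideanSpace ℂ G) where
  toFun g := LinearIsometryEquiv.piLpCongrLeft 2 ℂ ℂ (Equiv.mulRight g).symm
  map_one' := by
    ext v x
    exact congrArg v (mul_one x)
  map_mul' g h := by
    ext v x
    exact congrArg v (mul_assoc x g h).symm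

theorem rightRegular_apply (g : G) (v : EuclideanSpace ℂ G) (x : G) :
    rightRegular g v x = v (x * g) := rfl

theorem leftConv_rightRegular (f : G → ℂ) (g : G) (v : EuclideanSpace ℂ G) :
    leftConv f (rightRegular g v) = rightRegular g (leftConv f v) := by
  ext x
  rw [rightRegular_apply, leftConv_apply, leftConv_apply]
  refine Fintype.sum_equiv (Equiv.mulRight g) _ _ fun y ↦ ?_
  simp [rightRegular_apply, mul_assoc]

/-- The singular vectors of an operator `T` with `T* T` eigenvalue `l`. -/
def singularSpace {E : Type*} [NormedAddCommGroup E] [InnerProductSpace ℂ E] (T : E →ₗ[ℂ] E)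
    (l : ℝ) : Submodule ℂ E where
  carrier := {v | ∀ w, ⟪T w, T v⟫_ℂ = l * ⟪w, v⟫_ℂ}
  zero_mem' w := by simp
  add_mem' {a b} ha hb w := by
    rw [map_add, inner_add_right, inner_add_right, ha w, hb w, mul_add]
  smul_mem' c a ha w := by
    rw [map_smul, inner_smul_right, inner_smul_right, ha w, mul_left_comm]

theorem sq_norm_apply_of_mem_singularSpace {E : Type*} [NormedAddCommGroup E]
    [InnerProductSpace ℂ E] {T : E →ₗ[ℂ] E} {l : ℝ} {v : E} (hv : v ∈ singularSpace T l) :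
    ‖T v‖ ^ 2 = l * ‖v‖ ^ 2 := by
  have h := hv v
  rw [inner_self_eq_norm_sq_to_K, inner_self_eq_norm_sq_to_K] at h
  apply Complex.ofReal_injective
  push_cast
  exact h

theorem rightRegular_mem_singularSpace (f : G → ℂ) (l : ℝ) (g : G) {v : EuclideanSpace ℂ G}
    (hv : v ∈ singularSpace (leftConv f) l) :
    rightRegular g v ∈ singularSpace (leftConv f) l := fun w ↦ by
  obtain ⟨w, rfl⟩ := (rightRegular g).surjective w
  rw [leftConv_rightRegular, leftConv_rightRegular, LinearIsometryEquiv.inner_map_map,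
    LinearIsometryEquiv.inner_map_map, hv w]

theorem leftConv_eq_zero_of_fixed {f : G → ℂ} (hf : ∑ x, f x = 0) {v : EuclideanSpace ℂ G}
    (hv : ∀ g, rightRegular g v = v) : leftConv f v = 0 := by
  have hconst : ∀ y, v y = v 1 := fun y ↦ by
    conv_rhs => rw [← hv y, rightRegular_apply, one_mul]
  ext x
  have hsum : ∑ y, f (x * y⁻¹) = ∑ y, f y :=
    Fintype.sum_equiv ((Equiv.inv G).trans (Equiv.mulLeft x)) _ _ fun y ↦ rfl
  simp only [leftConv_apply, hconst, ← Finset.sum_mul]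
  rw [hsum, hf, zero_mul]
  rfl

/-- Bessel's inequality applied to the rows of `leftConv f`. -/
theorem sum_sq_norm_leftConv_le (f : G → ℂ) {ι : Type*} [Fintype ι]
    {e : ι → EuclideanSpace ℂ G} (he : Orthonormal ℂ e) :
    ∑ i, ‖leftConv f (e i)‖ ^ 2 ≤ Fintype.card G * ∑ x, ‖f x‖ ^ 2 := by
  let row : G → EuclideanSpace ℂ G := fun x ↦ WithLp.toLp 2 fun y ↦ star (f (x * y⁻¹))
  have hrow : ∀ x v, ⟪row x, v⟫_ℂ = leftConv f v x := fun x v ↦ by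
    simp [row, leftConv_apply, PiLp.inner_apply, mul_comm]
  have hnorm : ∀ x, ‖row x‖ ^ 2 = ∑ y, ‖f y‖ ^ 2 := fun x ↦ by
    rw [EuclideanSpace.norm_sq_eq]
    refine Fintype.sum_equiv ((Equiv.inv G).trans (Equiv.mulLeft x)) _ _ fun y ↦ ?_
    simp [row]
  calc ∑ i, ‖leftConv f (e i)‖ ^ 2 = ∑ x, ∑ i, ‖⟪e i, row x⟫_ℂ‖ ^ 2 := by
        rw [Finset.sum_comm]
        refine Finset.sum_congr rfl fun i _ ↦ ?_
        rw [EuclideanSpace.norm_sq_eq]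
        refine Finset.sum_congr rfl fun x _ ↦ ?_
        rw [← hrow, norm_inner_symm]
    _ ≤ ∑ x, ‖row x‖ ^ 2 := Finset.sum_le_sum fun x _ ↦ he.sum_inner_products_le (row x)
    _ = _ := by simp [hnorm]

end Convolution

theorem sq_norm_leftConv_le {F : Type*} [Field F] [Fintype F] [DecidableEq F]
    {f : SpecialLinearGroup (Fin 2) F → ℂ} (hf : ∑ x, f x = 0)
    (w : EuclideanSpace ℂ (SpecialLinearGroup (Fin 2) F)) :
    (Fintype.card F - 1 : ℝ) * ‖leftConv f w‖ ^ 2 ≤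
      2 * Fintype.card (SpecialLinearGroup (Fin 2) F) * (∑ x, ‖f x‖ ^ 2) * ‖w‖ ^ 2 := by
  obtain ⟨l, v, hv0, hv, hl⟩ := exists_sq_norm_apply_le (leftConv f)
  have hvV : v ∈ singularSpace (leftConv f) l := hv
  have hq : (1 : ℝ) ≤ Fintype.card F := by exact_mod_cast Fintype.card_pos
  have hnv : 0 < ‖v‖ ^ 2 := by positivity
  suffices h : (Fintype.card F - 1 : ℝ) * l ≤
      2 * Fintype.card (SpecialLinearGroup (Fin 2) F) * (∑ x, ‖f x‖ ^ 2) by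
    calc _ ≤ (Fintype.card F - 1 : ℝ) * (l * ‖w‖ ^ 2) := by
          gcongr
          exact hl w
      _ ≤ _ := by
          rw [← mul_assoc]
          gcongr
  by_cases hfix : ∀ g, rightRegular g v = v
  · have h0 := sq_norm_apply_of_mem_singularSpace hvV
    rw [leftConv_eq_zero_of_fixed hf hfix] at h0
    have : l = 0 := by simpa [hv0] using h0
    rw [this, mul_zero]
    positivity
  · obtain ⟨g, hg⟩ := not_forall.1 hfix
    have hinv : ∀ g, ∀ w ∈ singularSpace (leftConv f) l,
        rightRegular g w ∈ singularSpace (leftConv f) l := fun g w hw ↦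
      rightRegular_mem_singularSpace f l g hw
    obtain ⟨S, e, hcard, he, heV⟩ := exists_orthonormal_of_not_fixed
      (E := EuclideanSpace ℂ (SpecialLinearGroup (Fin 2) F)) rightRegular
      (singularSpace (leftConv f) l) hinv hvV hg
    have hsum := sum_sq_norm_leftConv_le f he
    simp only [fun i ↦ sq_norm_apply_of_mem_singularSpace (heV i), he.1] at hsum
    have hl0 : 0 ≤ l := by nlinarith [hl v, sq_nonneg ‖leftConv f v‖]
    have hcard' : (Fintype.card F : ℝ) ≤ 2 * S.card + 1 := by exact_mod_cast hcard
    have : (S.card : ℝ) * l ≤ Fintype.card (SpecialLinearGroup (Fin 2) F) * ∑ x, ‖f x‖ ^ 2 := by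
      simpa using hsum
    nlinarith

/-- Gowers' product theorem for `SL₂(F)`. -/
theorem card_pow_three_le_of_not_mem_mul {F : Type*} [Field F] [Fintype F] [DecidableEq F]
    [DecidableEq (SpecialLinearGroup (Fin 2) F)]
    {A : Finset (SpecialLinearGroup (Fin 2) F)} {x : SpecialLinearGroup (Fin 2) F}
    (hx : x ∉ A * A * A) :
    (Fintype.card F - 1 : ℝ) * (A.card : ℝ) ^ 3 ≤
      2 * (Fintype.card (SpecialLinearGroup (Fin 2) F) : ℝ) ^ 3 := by
  set N : ℝ := (Fintype.card (SpecialLinearGroup (Fin 2) F) : ℝ) with hN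
  have hNpos : 0 < N := by rw [hN]; exact_mod_cast Fintype.card_pos
  rcases A.eq_empty_or_nonempty with rfl | hA
  · simp; positivity
  have hApos : (0 : ℝ) < A.card := by exact_mod_cast hA.card_pos
  let f : SpecialLinearGroup (Fin 2) F → ℂ := fun y ↦
    (((if y ∈ A then 1 else 0) - A.card / N : ℝ) : ℂ)
  let w : EuclideanSpace ℂ (SpecialLinearGroup (Fin 2) F) :=
    WithLp.toLp 2 fun y ↦ if y ∈ A then 1 else 0
  have hf : ∑ y, f y = 0 := by
    simp only [f, ← Complex.ofReal_sum]
    norm_cast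
    rw [Finset.sum_sub_distrib]
    simp [← hN]
    field_simp
    simp
  have hf2 : ∑ y, ‖f y‖ ^ 2 ≤ A.card := by
    have : ∀ y, ‖f y‖ ^ 2 =
        (1 - 2 * (A.card / N)) * (if y ∈ A then 1 else 0) + (A.card / N) ^ 2 := fun y ↦ by
      simp only [f, Complex.norm_real, Real.norm_eq_abs, sq_abs]
      split_ifs <;> ring
    simp only [this, Finset.sum_add_distrib, ← Finset.mul_sum]
    simp [← hN]
    have : 0 ≤ (A.card : ℝ) ^ 2 / N := by positivity
    field_simp
    nlinarith
  have hw : ‖w‖ ^ 2 = A.card := by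
    rw [EuclideanSpace.norm_sq_eq]
    simp [w, apply_ite]
  have hval : ∀ c ∈ A, leftConv f w (x * c⁻¹) = ((-(A.card ^ 2 / N) : ℝ) : ℂ) := fun c hc ↦ by
    have hterm : ∀ y, f (x * c⁻¹ * y⁻¹) * w y =
        ((-(A.card / N) * if y ∈ A then 1 else 0 : ℝ) : ℂ) := fun y ↦ by
      by_cases hy : y ∈ A
      · have hne : x * c⁻¹ * y⁻¹ ∉ A := fun h ↦ hx <| by
          have := Finset.mul_mem_mul (Finset.mul_mem_mul h hy) hc
          simpa using this
        simp [f, w, hy, hne]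
      · simp [w, hy]
    rw [leftConv_apply]
    simp only [hterm, ← Complex.ofReal_sum, ← Finset.mul_sum]
    norm_cast
    simp
    ring
  have hlow : A.card * (A.card ^ 2 / N) ^ 2 ≤ ‖leftConv f w‖ ^ 2 := by
    rw [EuclideanSpace.norm_sq_eq]
    calc (A.card * (A.card ^ 2 / N) ^ 2 : ℝ)
        = ∑ z ∈ A.image (fun c ↦ x * c⁻¹), ‖leftConv f w z‖ ^ 2 := by
          rw [Finset.sum_image (by simp [Set.InjOn])]
          rw [Finset.sum_congr rfl fun c hc ↦ by rw [hval c hc, Complex.norm_real, Real.norm_eq_abs, sq_abs]]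
          simp
      _ ≤ _ := Finset.sum_le_sum_of_subset_of_nonneg (Finset.subset_univ _)
          fun _ _ _ ↦ by positivity
  have hq : (1 : ℝ) ≤ Fintype.card F := by exact_mod_cast Fintype.card_pos
  have main := sq_norm_leftConv_le hf w
  rw [hw, ← hN] at main
  have h1 : (Fintype.card F - 1 : ℝ) * (A.card * (A.card ^ 2 / N) ^ 2) ≤
      2 * N * A.card * A.card := by
    calc _ ≤ (Fintype.card F - 1 : ℝ) * ‖leftConv f w‖ ^ 2 := by
          gcongr
      _ ≤ _ := main
      _ ≤ _ := by gcongr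
  have h2 : (Fintype.card F - 1 : ℝ) * (A.card * (A.card ^ 2 / N) ^ 2) =
      ((Fintype.card F - 1 : ℝ) * A.card ^ 3) * (A.card ^ 2 / N ^ 2) := by
    ring
  have h3 : 2 * N * A.card * A.card = (2 * N ^ 3) * ((A.card : ℝ) ^ 2 / N ^ 2) := by
    field_simp
  rw [h2, h3] at h1
  exact le_of_mul_le_mul_right h1 (by positivity)

theorem stmt_12 :
    ∃ C : ℝ, 0 < C ∧
      ∀ (F : Type) [Field F] [Fintype F] [DecidableEq F]
        [DecidableEq (Matrix.SpecialLinearGroup (Fin 2) F)]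
        (A : Finset (Matrix.SpecialLinearGroup (Fin 2) F)),
        C * (Fintype.card F : ℝ) ^ ((8 : ℝ) / 3) < A.card →
        A * A * A = Finset.univ := by
  refine ⟨4, by norm_num, fun F _ _ _ _ A hA ↦ Finset.eq_univ_iff_forall.2 fun x ↦ ?_⟩
  by_contra hx
  have hle := card_pow_three_le_of_not_mem_mul hx
  have hN : (Fintype.card (SpecialLinearGroup (Fin 2) F) : ℝ) ≤ 2 * (Fintype.card F : ℝ) ^ 3 := by
    exact_mod_cast card_specialLinearGroup_le
  have hq : (2 : ℝ) ≤ Fintype.card F := by exact_mod_cast Fintype.one_lt_card (α := F)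
  set q : ℝ := (Fintype.card F : ℝ)
  have hpow : (4 * q ^ ((8 : ℝ) / 3)) ^ 3 = 64 * q ^ 8 := by
    rw [mul_pow, ← Real.rpow_mul_natCast (by linarith)]
    norm_num
  have hA3 : 64 * q ^ 8 < (A.card : ℝ) ^ 3 := by
    rw [← hpow]
    gcongr
  have hN3 : (Fintype.card (SpecialLinearGroup (Fin 2) F) : ℝ) ^ 3 ≤ (2 * q ^ 3) ^ 3 := by
    gcongr
  have h8 : 0 < q ^ 8 := by positivity
  nlinarith [mul_lt_mul_of_pos_left hA3 (show 0 < q - 1 by linarith)]
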